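/- Let n ≥ 1 be arbitrary and set k = ⌊n/2⌋. Then the convex hull of the n×n totally symmetric ASMs in ℝ^{n×n} equals P_ASM ∩ P_TS ∩ {X ∈ ℝ^{n×n} : x_{i,k+1} = x_{k+1,i} = (−1)^{i+1} for all i ∈ {1,…,n}}, and this set also equals conv(VSASM(n)) ∩ P_DS; moreover, for every odd n ≥ 3 the dimension of conv(TSASM(n)) equals (n−5)(n−3)/8. -/

import Mathlib

/-- An `n × n` alternating sign matrix: entries in `{-1, 0, 1}`, all row- and
column-prefix sums lie in `{0, 1}`, and all full row and column sums equal `1`. -/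
def IsASM (n : ℕ) (X : Fin n → Fin n → ℝ) : Prop :=
  (∀ i j, X i j = -1 ∨ X i j = 0 ∨ X i j = 1) ∧
  (∀ i j, (∑ j' ∈ Finset.Iic j, X i j') = 0 ∨ (∑ j' ∈ Finset.Iic j, X i j') = 1) ∧
  (∀ i j, (∑ i' ∈ Finset.Iic i, X i' j) = 0 ∨ (∑ i' ∈ Finset.Iic i, X i' j) = 1) ∧
  (∀ i, (∑ j, X i j) = 1) ∧
  (∀ j, (∑ i, X i j) = 1)

open MeasureTheory in
/-- The floors `⌊x + θ⌋`, for `θ` uniform on `[0, 1)`, average to `x`. -/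
theorem integral_floor_add (x : ℝ) :
    IntegrableOn (fun θ : ℝ => (⌊x + θ⌋ : ℝ)) (Set.Ico 0 1) ∧
      ∫ θ in Set.Ico (0 : ℝ) 1, (⌊x + θ⌋ : ℝ) = x := by
  have hf0 := Int.fract_nonneg x
  have hf1 := Int.fract_lt_one x
  have hx := Int.floor_add_fract x
  have hfloor : Set.EqOn (fun θ : ℝ => (⌊x + θ⌋ : ℝ))
      (fun θ => (⌊x⌋ : ℝ) + (Set.Ico (1 - Int.fract x) 1).indicator (fun _ => (1 : ℝ)) θ)
      (Set.Ico 0 1) := by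
    intro θ hθ
    obtain ⟨h0, h1⟩ := hθ
    by_cases h : 1 - Int.fract x ≤ θ
    · have hz : ⌊x + θ⌋ = ⌊x⌋ + 1 := by
        rw [Int.floor_eq_iff]; push_cast; constructor <;> linarith
      simp [hz, h, h1]
    · have hz : ⌊x + θ⌋ = ⌊x⌋ := by
        rw [Int.floor_eq_iff]; constructor <;> linarith
      simp [hz, h]
  have hind : IntegrableOn
      ((Set.Ico (1 - Int.fract x) 1).indicator (fun _ => (1 : ℝ))) (Set.Ico 0 1) :=
    (integrable_const (1 : ℝ)).indicator measurableSet_Ico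
  have hconst : IntegrableOn (fun _ : ℝ => (⌊x⌋ : ℝ)) (Set.Ico 0 1) := integrable_const _
  refine ⟨(integrableOn_congr_fun hfloor measurableSet_Ico).2 (hconst.add hind), ?_⟩
  rw [setIntegral_congr_fun measurableSet_Ico hfloor, integral_add hconst hind,
    setIntegral_indicator measurableSet_Ico, Set.Ico_inter_Ico]
  have hmax : max 0 (1 - Int.fract x) = 1 - Int.fract x := max_eq_right (by linarith)
  simp only [integral_const, hmax, min_self]
  simp [hf0]

/-- Corner sums, on the `k × k` upper left quadrant, of a point of the polytope of totally
symmetric alternating sign matrices of size `2 * k + 1`. -/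
structure IsQuadrantCornerSum (k : ℕ) (c : ℕ → ℕ → ℝ) : Prop where
  symm : ∀ a ≤ k, ∀ b ≤ k, c a b = c b a
  zero_left : ∀ b ≤ k, c 0 b = 0
  last : ∀ a ≤ k, c a k = ((a / 2 : ℕ) : ℝ)
  le_succ : ∀ a < k, ∀ b ≤ k, c a b ≤ c (a + 1) b
  succ_le : ∀ a < k, ∀ b ≤ k, c (a + 1) b ≤ c a b + 1

/-- The entries of the totally symmetric matrix of size `2 * k + 1` with alternating middle row
and column whose corner sums on the upper left quadrant are `c`. -/
def quadrantEntry (k : ℕ) (c : ℕ → ℕ → ℝ) (a b : ℕ) : ℝ :=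
  if a = k then (-1) ^ b
  else if b = k then (-1) ^ a
  else c (min a (2 * k - a) + 1) (min b (2 * k - b) + 1)
    - c (min a (2 * k - a)) (min b (2 * k - b) + 1)
    - c (min a (2 * k - a) + 1) (min b (2 * k - b))
    + c (min a (2 * k - a)) (min b (2 * k - b))

/-- The prefix sums of the rows of `quadrantEntry`. -/
def quadrantRowSum (k : ℕ) (c : ℕ → ℕ → ℝ) (a m : ℕ) : ℝ :=
  if a = k then ((m % 2 : ℕ) : ℝ)
  else if m ≤ k then c (min a (2 * k - a) + 1) m - c (min a (2 * k - a)) m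
  else 1 - (c (min a (2 * k - a) + 1) (2 * k + 1 - m) - c (min a (2 * k - a)) (2 * k + 1 - m))

theorem neg_one_pow_eq_one_sub_two_mul_mod_two (a : ℕ) :
    (-1 : ℝ) ^ a = 1 - 2 * ((a % 2 : ℕ) : ℝ) := by
  rcases Nat.even_or_odd a with h | h
  · rw [h.neg_one_pow, Nat.even_iff.1 h]; simp
  · rw [h.neg_one_pow, Nat.odd_iff.1 h]; norm_num

theorem cast_succ_div_two (a : ℕ) :
    (((a + 1) / 2 : ℕ) : ℝ) = ((a / 2 : ℕ) : ℝ) + ((a % 2 : ℕ) : ℝ) := by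
  norm_cast; omega

theorem quadrantEntry_comm {k : ℕ} {c : ℕ → ℕ → ℝ} (hc : ∀ a ≤ k, ∀ b ≤ k, c a b = c b a)
    {a b : ℕ} (ha : a ≤ 2 * k) (hb : b ≤ 2 * k) :
    quadrantEntry k c a b = quadrantEntry k c b a := by
  unfold quadrantEntry
  by_cases h1 : a = k
  · by_cases h2 : b = k <;> simp [h1, h2]
  · by_cases h2 : b = k
    · simp [h1, h2]
    · simp only [h1, h2, if_false]
      rw [hc (min a (2 * k - a) + 1) (by omega) (min b (2 * k - b) + 1) (by omega),
        hc (min a (2 * k - a)) (by omega) (min b (2 * k - b) + 1) (by omega),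
        hc (min a (2 * k - a) + 1) (by omega) (min b (2 * k - b)) (by omega),
        hc (min a (2 * k - a)) (by omega) (min b (2 * k - b)) (by omega)]
      ring

theorem quadrantEntry_reflect (k : ℕ) (c : ℕ → ℕ → ℝ) (a : ℕ) {b : ℕ} (hb : b ≤ 2 * k) :
    quadrantEntry k c a (2 * k - b) = quadrantEntry k c a b := by
  have h1 : (2 * k - b = k) = (b = k) := by apply propext; omega
  have h2 : min (2 * k - b) (2 * k - (2 * k - b)) = min b (2 * k - b) := by omega
  have h3 : (-1 : ℝ) ^ (2 * k - b) = (-1) ^ b := by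
    rw [neg_one_pow_eq_one_sub_two_mul_mod_two, neg_one_pow_eq_one_sub_two_mul_mod_two,
      show (2 * k - b) % 2 = b % 2 by omega]
  simp only [quadrantEntry, h1, h2, h3]

namespace IsQuadrantCornerSum

variable {k : ℕ} {c : ℕ → ℕ → ℝ}

theorem zero_right (hc : IsQuadrantCornerSum k c) {a : ℕ} (ha : a ≤ k) : c a 0 = 0 := by
  rw [hc.symm a ha 0 (Nat.zero_le _), hc.zero_left a ha]

theorem one_left (hc : IsQuadrantCornerSum k c) {b : ℕ} (hk : 1 ≤ k) (hb : b ≤ k) :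
    c 1 b = 0 := by
  have hmono : ∀ d, b ≤ d → d ≤ k → c b 1 ≤ c d 1 := by
    intro d hbd
    induction d, hbd using Nat.le_induction with
    | base => simp
    | succ d _ ih => exact fun hd => (ih (by omega)).trans (hc.le_succ d (by omega) 1 hk)
  have h1 := hmono k hb le_rfl
  have h2 := hc.le_succ 0 (by omega) b hb
  rw [hc.zero_left b hb] at h2
  rw [hc.symm k le_rfl 1 hk, hc.last 1 hk, hc.symm b hb 1 hk] at h1
  norm_num at h1 h2
  linarith

theorem sum_quadrantEntry (hc : IsQuadrantCornerSum k c) {a : ℕ} (ha : a ≤ 2 * k) {m : ℕ}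
    (hm : m ≤ 2 * k + 1) :
    ∑ b ∈ Finset.range m, quadrantEntry k c a b = quadrantRowSum k c a m := by
  induction m with
  | zero =>
    unfold quadrantRowSum
    by_cases h : a = k
    · simp [h]
    · simp only [h, if_false, Nat.zero_le, if_true, Finset.range_zero, Finset.sum_empty]
      rw [hc.zero_right (by omega), hc.zero_right (by omega), sub_zero]
  | succ m ih =>
    rw [Finset.sum_range_succ, ih (by omega)]
    unfold quadrantRowSum quadrantEntry
    by_cases h : a = k
    · simp only [h, if_true]
      rw [neg_one_pow_eq_one_sub_two_mul_mod_two]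
      rcases Nat.mod_two_eq_zero_or_one m with h2 | h2
      · rw [h2, show (m + 1) % 2 = 1 by omega]; norm_num
      · rw [h2, show (m + 1) % 2 = 0 by omega]; norm_num
    · simp only [h, if_false]
      rcases lt_trichotomy m k with h2 | h2 | h2
      · simp only [h2.le, h2.ne, if_true, if_false, show m + 1 ≤ k from h2,
          show min m (2 * k - m) = m by omega]
        ring
      · subst h2
        have h4 : 2 * m + 1 - (m + 1) = m := by omega
        have h5 : (-1 : ℝ) ^ a = (-1) ^ (min a (2 * m - a)) := by
          rw [neg_one_pow_eq_one_sub_two_mul_mod_two, neg_one_pow_eq_one_sub_two_mul_mod_two,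
            show min a (2 * m - a) % 2 = a % 2 by omega]
        simp only [le_refl, if_true, show ¬ m + 1 ≤ m by omega, if_false, h4]
        rw [h5, hc.last _ (by omega), hc.last _ (by omega), cast_succ_div_two,
          neg_one_pow_eq_one_sub_two_mul_mod_two]
        ring
      · simp only [show ¬ m ≤ k by omega, show ¬ m = k by omega, show ¬ m + 1 ≤ k by omega,
          if_false, show min m (2 * k - m) = 2 * k - m by omega,
          show 2 * k + 1 - m = 2 * k - m + 1 by omega,
          show 2 * k + 1 - (m + 1) = 2 * k - m by omega]
        ring

theorem quadrantRowSum_nonneg (hc : IsQuadrantCornerSum k c) {a m : ℕ} (ha : a ≤ 2 * k)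
    (hm : m ≤ 2 * k + 1) : 0 ≤ quadrantRowSum k c a m := by
  unfold quadrantRowSum
  split_ifs with h1 h2
  · positivity
  · linarith [hc.le_succ (min a (2 * k - a)) (by omega) m h2]
  · linarith [hc.succ_le (min a (2 * k - a)) (by omega) (2 * k + 1 - m) (by omega)]

theorem quadrantRowSum_le_one (hc : IsQuadrantCornerSum k c) {a m : ℕ} (ha : a ≤ 2 * k)
    (hm : m ≤ 2 * k + 1) : quadrantRowSum k c a m ≤ 1 := by
  unfold quadrantRowSum
  split_ifs with h1 h2
  · norm_cast; omega
  · linarith [hc.succ_le (min a (2 * k - a)) (by omega) m h2]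
  · linarith [hc.le_succ (min a (2 * k - a)) (by omega) (2 * k + 1 - m) (by omega)]

theorem quadrantRowSum_last (hc : IsQuadrantCornerSum k c) {a : ℕ} (ha : a ≤ 2 * k) :
    quadrantRowSum k c a (2 * k + 1) = 1 := by
  unfold quadrantRowSum
  split_ifs with h1 h2
  · rw [show (2 * k + 1) % 2 = 1 by omega]; simp
  · omega
  · rw [Nat.sub_self, hc.zero_right (by omega), hc.zero_right (by omega)]; norm_num

theorem quadrantRowSum_eq_zero_or_one (hc : IsQuadrantCornerSum k c)
    (hz : ∀ a b, ∃ z : ℤ, c a b = z) {a m : ℕ} (ha : a ≤ 2 * k) (hm : m ≤ 2 * k + 1) :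
    quadrantRowSum k c a m = 0 ∨ quadrantRowSum k c a m = 1 := by
  obtain ⟨z, h⟩ : ∃ z : ℤ, quadrantRowSum k c a m = z := by
    choose z hz using hz
    unfold quadrantRowSum
    split_ifs
    · exact ⟨((m % 2 : ℕ) : ℤ), by rw [Int.cast_natCast]⟩
    · exact ⟨z _ _ - z _ _, by rw [hz, hz]; push_cast; rfl⟩
    · exact ⟨1 - (z _ _ - z _ _), by rw [hz, hz]; push_cast; rfl⟩
  have h0 := hc.quadrantRowSum_nonneg ha hm
  have h1 := hc.quadrantRowSum_le_one ha hm
  rw [h] at h0 h1 ⊢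
  norm_cast at h0 h1 ⊢
  omega

theorem sum_sum_quadrantEntry (hc : IsQuadrantCornerSum k c) {a b : ℕ} (ha : a ≤ k)
    (hb : b ≤ k) :
    ∑ a' ∈ Finset.range a, ∑ b' ∈ Finset.range b, quadrantEntry k c a' b' = c a b := by
  induction a with
  | zero => simp [hc.zero_left b hb]
  | succ a ih =>
    rw [Finset.sum_range_succ, ih (by omega), hc.sum_quadrantEntry (by omega) (by omega)]
    simp [quadrantRowSum, show a ≠ k by omega, hb, show min a (2 * k - a) = a by omega]

theorem floor_add (hc : IsQuadrantCornerSum k c) {θ : ℝ} (h0 : 0 ≤ θ) (h1 : θ < 1) :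
    IsQuadrantCornerSum k (fun a b => (⌊c a b + θ⌋ : ℝ)) where
  symm a ha b hb := by rw [hc.symm a ha b hb]
  zero_left b hb := by
    rw [hc.zero_left b hb, zero_add, Int.floor_eq_zero_iff.2 ⟨h0, h1⟩, Int.cast_zero]
  last a ha := by
    rw [hc.last a ha, Int.floor_natCast_add, Int.floor_eq_zero_iff.2 ⟨h0, h1⟩, add_zero,
      Int.cast_natCast]
  le_succ a ha b hb := by
    have := hc.le_succ a ha b hb
    exact_mod_cast Int.floor_mono (by linarith)
  succ_le a ha b hb := by
    have := hc.succ_le a ha b hb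
    have h : ⌊c (a + 1) b + θ⌋ ≤ ⌊c a b + θ + 1⌋ := Int.floor_mono (by linarith)
    rw [Int.floor_add_one] at h
    exact_mod_cast h

end IsQuadrantCornerSum

theorem Fin.sum_Iic_val {n : ℕ} (g : ℕ → ℝ) (j : Fin n) :
    ∑ j' ∈ Finset.Iic j, g j' = ∑ b ∈ Finset.range (j + 1), g b := by
  have h : Finset.range ((j : ℕ) + 1) = (Finset.Iic j).map Fin.valEmbedding := by
    rw [Fin.map_valEmbedding_Iic]; ext; simp
  rw [h, Finset.sum_map]; rfl

/-- A sum over `k + r + k` terms whose first and last `k` terms mirror each other. -/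
theorem sum_range_of_reflect (g : ℕ → ℝ) (k r : ℕ)
    (h : ∀ b < k, g (k + r + k - 1 - b) = g b) :
    ∑ b ∈ Finset.range (k + r + k), g b
      = 2 * ∑ b ∈ Finset.range k, g b + ∑ b ∈ Finset.range r, g (k + b) := by
  rw [Finset.sum_range_add, Finset.sum_range_add]
  have h2 : ∑ x ∈ Finset.range k, g (k + r + x) = ∑ b ∈ Finset.range k, g b := by
    rw [← Finset.sum_range_reflect]
    refine Finset.sum_congr rfl fun b hb => ?_
    rw [Finset.mem_range] at hb
    rw [← h b hb]; congr 1; omega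
  rw [h2]; ring

/-- The entry of a matrix at a pair of natural numbers, zero outside of the matrix. -/
def entryAt (n a b : ℕ) : (Fin n → Fin n → ℝ) →ₗ[ℝ] ℝ :=
  if h : a < n ∧ b < n then LinearMap.proj (⟨b, h.2⟩ : Fin n) ∘ₗ LinearMap.proj (⟨a, h.1⟩ : Fin n)
  else 0

/-- The sum of the entries in the first `a` rows and the first `b` columns. -/
def cornerSum (n a b : ℕ) : (Fin n → Fin n → ℝ) →ₗ[ℝ] ℝ :=
  ∑ a' ∈ Finset.range a, ∑ b' ∈ Finset.range b, entryAt n a' b'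

theorem entryAt_val {n : ℕ} (X : Fin n → Fin n → ℝ) (i j : Fin n) :
    entryAt n i j X = X i j := by
  simp [entryAt]

theorem entryAt_of_lt {n a b : ℕ} (X : Fin n → Fin n → ℝ) (ha : a < n) (hb : b < n) :
    entryAt n a b X = X ⟨a, ha⟩ ⟨b, hb⟩ :=
  entryAt_val X ⟨a, ha⟩ ⟨b, hb⟩

theorem cornerSum_succ_left (n a b : ℕ) (X : Fin n → Fin n → ℝ) :
    cornerSum n (a + 1) b X
      = cornerSum n a b X + ∑ b' ∈ Finset.range b, entryAt n a b' X := by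
  simp [cornerSum, Finset.sum_range_succ]

theorem entryAt_eq_cornerSum (n a b : ℕ) (X : Fin n → Fin n → ℝ) :
    entryAt n a b X = cornerSum n (a + 1) (b + 1) X - cornerSum n a (b + 1) X
      - cornerSum n (a + 1) b X + cornerSum n a b X := by
  rw [cornerSum_succ_left, cornerSum_succ_left, Finset.sum_range_succ]; ring

section EntryAt

variable {n : ℕ} {X : Fin n → Fin n → ℝ}

theorem entryAt_comm (h : ∀ i j, X i j = X j i) (a b : ℕ) :
    entryAt n a b X = entryAt n b a X := by
  by_cases hab : a < n ∧ b < n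
  · rw [entryAt_of_lt X hab.1 hab.2, entryAt_of_lt X hab.2 hab.1, h]
  · rw [entryAt, entryAt, dif_neg hab, dif_neg (fun h => hab ⟨h.2, h.1⟩)]

theorem entryAt_reflect (h : ∀ i j, X i j = X i j.rev) {a b : ℕ} (ha : a < n) (hb : b < n) :
    entryAt n a (n - 1 - b) X = entryAt n a b X := by
  rw [entryAt_of_lt X ha (by omega), entryAt_of_lt X ha hb, h ⟨a, ha⟩ ⟨b, hb⟩]
  congr 1
  ext; simp [Fin.rev]; omega

theorem cornerSum_comm (h : ∀ i j, X i j = X j i) (a b : ℕ) :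
    cornerSum n a b X = cornerSum n b a X := by
  simp only [cornerSum, LinearMap.sum_apply]
  rw [Finset.sum_comm]
  exact Finset.sum_congr rfl fun _ _ => Finset.sum_congr rfl fun _ _ => entryAt_comm h _ _

theorem cornerSum_zero_left (b : ℕ) : cornerSum n 0 b X = 0 := by simp [cornerSum]

theorem sum_range_entryAt_row {a b : ℕ} (ha : a < n) (hb : b < n) :
    ∑ b' ∈ Finset.range (b + 1), entryAt n a b' X
      = ∑ j' ∈ Finset.Iic (⟨b, hb⟩ : Fin n), X ⟨a, ha⟩ j' := by
  rw [← Fin.sum_Iic_val (fun b' => entryAt n a b' X) ⟨b, hb⟩]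
  exact Finset.sum_congr rfl fun j _ => entryAt_val X ⟨a, ha⟩ j

theorem sum_range_entryAt_column {a b : ℕ} (ha : a < n) (hb : b < n) :
    ∑ a' ∈ Finset.range (a + 1), entryAt n a' b X
      = ∑ i' ∈ Finset.Iic (⟨a, ha⟩ : Fin n), X i' ⟨b, hb⟩ := by
  rw [← Fin.sum_Iic_val (fun a' => entryAt n a' b X) ⟨a, ha⟩]
  exact Finset.sum_congr rfl fun i _ => entryAt_val X i ⟨b, hb⟩

theorem sum_range_entryAt_full_row {a : ℕ} (ha : a < n) :
    ∑ b' ∈ Finset.range n, entryAt n a b' X = ∑ j, X ⟨a, ha⟩ j := by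
  rw [Finset.sum_range]
  exact Finset.sum_congr rfl fun j _ => entryAt_val X ⟨a, ha⟩ j

end EntryAt

/-- The matrices whose row prefix sums lie in `[0, 1]` and whose row sums are `1`. -/
def rowPolytope (n : ℕ) : Set (Fin n → Fin n → ℝ) :=
  {X | (∀ i j, ∑ j' ∈ Finset.Iic j, X i j' ∈ Set.Icc (0 : ℝ) 1) ∧ ∀ i, ∑ j, X i j = 1}

theorem convex_rowPolytope (n : ℕ) : Convex ℝ (rowPolytope n) := by
  intro X hX Y hY s t hs ht hst
  refine ⟨fun i j => ?_, fun i => ?_⟩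
  · have := convex_Icc (0 : ℝ) 1 (hX.1 i j) (hY.1 i j) hs ht hst
    simpa [Finset.sum_add_distrib, Finset.mul_sum] using this
  · simp [Finset.sum_add_distrib, ← Finset.mul_sum, hX.2, hY.2, hst]

theorem IsASM.mem_rowPolytope {n : ℕ} {X : Fin n → Fin n → ℝ} (h : IsASM n X) :
    X ∈ rowPolytope n := by
  refine ⟨fun i j => ?_, h.2.2.2.1⟩
  rcases h.2.1 i j with h | h <;> rw [h] <;> simp

theorem convexHull_isASM_subset_rowPolytope (n : ℕ) :
    convexHull ℝ {X | IsASM n X} ⊆ rowPolytope n :=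
  convexHull_min (fun _ h => IsASM.mem_rowPolytope h) (convex_rowPolytope n)

section RowPolytope

variable {n : ℕ} {X : Fin n → Fin n → ℝ}

theorem sum_range_mem_Icc_of_mem_rowPolytope (hX : X ∈ rowPolytope n) {a m : ℕ} (ha : a < n)
    (hm : m ≤ n) : ∑ b ∈ Finset.range m, entryAt n a b X ∈ Set.Icc (0 : ℝ) 1 := by
  cases m with
  | zero => simp
  | succ m => rw [sum_range_entryAt_row ha hm]; exact hX.1 _ _

/-- In a row of a vertically symmetric matrix of odd size, the left half and the middle entry
determine each other. -/
theorem two_mul_sum_add_middle {k : ℕ} {X : Fin (2 * k + 1) → Fin (2 * k + 1) → ℝ}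
    (hX : ∀ i, ∑ j, X i j = 1) (hv : ∀ i j, X i j = X i j.rev) {a : ℕ} (ha : a < 2 * k + 1) :
    2 * ∑ b ∈ Finset.range k, entryAt (2 * k + 1) a b X + entryAt (2 * k + 1) a k X = 1 := by
  have h := sum_range_of_reflect (fun b => entryAt (2 * k + 1) a b X) k 1 (fun b hb => by
    rw [← entryAt_reflect hv ha (show b < 2 * k + 1 by omega)]
    congr 2; omega)
  rw [show k + 1 + k = 2 * k + 1 by omega, sum_range_entryAt_full_row ha, hX] at h
  simpa using h.symm

theorem two_mul_sum_of_even {k : ℕ} {X : Fin (2 * k) → Fin (2 * k) → ℝ}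
    (hX : ∀ i, ∑ j, X i j = 1) (hv : ∀ i j, X i j = X i j.rev) {a : ℕ} (ha : a < 2 * k) :
    2 * ∑ b ∈ Finset.range k, entryAt (2 * k) a b X = 1 := by
  have h := sum_range_of_reflect (fun b => entryAt (2 * k) a b X) k 0 (fun b hb => by
    rw [← entryAt_reflect hv ha (show b < 2 * k by omega)]
    congr 2; omega)
  rw [show k + 0 + k = 2 * k by omega, sum_range_entryAt_full_row ha, hX] at h
  simpa using h.symm

theorem sum_range_row_eq_zero_or_one (h : IsASM n X) {a m : ℕ} (ha : a < n) (hm : m ≤ n) :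
    ∑ b ∈ Finset.range m, entryAt n a b X = 0 ∨ ∑ b ∈ Finset.range m, entryAt n a b X = 1 := by
  cases m with
  | zero => simp
  | succ m => rw [sum_range_entryAt_row ha hm]; exact h.2.1 _ _

theorem sum_range_column_eq_zero_or_one (h : IsASM n X) {m b : ℕ} (hm : m ≤ n) (hb : b < n) :
    ∑ a ∈ Finset.range m, entryAt n a b X = 0 ∨ ∑ a ∈ Finset.range m, entryAt n a b X = 1 := by
  cases m with
  | zero => simp
  | succ m => rw [sum_range_entryAt_column hm hb]; exact h.2.2.1 _ _

/-- The middle column of a vertically symmetric alternating sign matrix alternates. -/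
theorem IsASM.middle_column {k : ℕ} {X : Fin (2 * k + 1) → Fin (2 * k + 1) → ℝ}
    (h : IsASM (2 * k + 1) X) (hv : ∀ i j, X i j = X i j.rev) {a : ℕ} (ha : a < 2 * k + 1) :
    entryAt (2 * k + 1) a k X = (-1) ^ a := by
  have hsum : ∀ m ≤ 2 * k + 1,
      ∑ a ∈ Finset.range m, entryAt (2 * k + 1) a k X = ((m % 2 : ℕ) : ℝ) ∧
        ∀ a < m, entryAt (2 * k + 1) a k X = (-1) ^ a := by
    intro m
    induction m with
    | zero => simp
    | succ m ih =>
      intro hm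
      obtain ⟨ih1, ih2⟩ := ih (by omega)
      have h1 := two_mul_sum_add_middle h.2.2.2.1 hv (show m < 2 * k + 1 by omega)
      have h2 := sum_range_row_eq_zero_or_one h (show m < 2 * k + 1 by omega)
        (show k ≤ 2 * k + 1 by omega)
      have h3 := sum_range_column_eq_zero_or_one h hm (show k < 2 * k + 1 by omega)
      rw [Finset.sum_range_succ, ih1] at h3 ⊢
      have hlast : entryAt (2 * k + 1) m k X = (-1) ^ m := by
        rw [neg_one_pow_eq_one_sub_two_mul_mod_two]
        rcases Nat.mod_two_eq_zero_or_one m with hm2 | hm2 <;> rw [hm2] at h3 ⊢ <;>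
          rcases h2 with h2 | h2 <;> rw [h2] at h1 <;> rcases h3 with h3 | h3 <;>
          norm_num at h1 h3 ⊢ <;> linarith
      refine ⟨?_, fun a ha => ?_⟩
      · rw [hlast, neg_one_pow_eq_one_sub_two_mul_mod_two]
        rcases Nat.mod_two_eq_zero_or_one m with hm2 | hm2
        · rw [hm2, show (m + 1) % 2 = 1 by omega]; norm_num
        · rw [hm2, show (m + 1) % 2 = 0 by omega]; norm_num
      · rcases Nat.lt_succ_iff_lt_or_eq.1 ha with ha | rfl
        · exact ih2 a ha
        · exact hlast
  exact (hsum (2 * k + 1) le_rfl).2 a ha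

end RowPolytope

/-- Totally symmetric alternating sign matrices. -/
def tsasm (n : ℕ) : Set (Fin n → Fin n → ℝ) :=
  {X | IsASM n X ∧ (∀ i j, X i j = X i j.rev) ∧ (∀ i j, X i j = X j i)}

/-- The linear description of the polytope of totally symmetric alternating sign matrices of size
`2 * k + 1`. -/
structure IsTSPoint (k : ℕ) (X : Fin (2 * k + 1) → Fin (2 * k + 1) → ℝ) : Prop where
  row : X ∈ rowPolytope (2 * k + 1)
  vert : ∀ i j, X i j = X i j.rev
  diag : ∀ i j, X i j = X j i
  mid : ∀ a < 2 * k + 1, entryAt (2 * k + 1) a k X = (-1) ^ a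

/-- The totally symmetric matrix determined by corner sums on the upper left quadrant. -/
def quadrantMatrix (k : ℕ) (c : ℕ → ℕ → ℝ) : Fin (2 * k + 1) → Fin (2 * k + 1) → ℝ :=
  fun i j => quadrantEntry k c i j

theorem quadrantMatrix_vert (k : ℕ) (c : ℕ → ℕ → ℝ) (i j : Fin (2 * k + 1)) :
    quadrantMatrix k c i j = quadrantMatrix k c i j.rev := by
  rw [quadrantMatrix, quadrantMatrix, ← quadrantEntry_reflect k c i (show (j : ℕ) ≤ 2 * k by omega)]
  congr 1
  simp [Fin.rev]

theorem IsQuadrantCornerSum.quadrantMatrix_mem_tsasm {k : ℕ} {c : ℕ → ℕ → ℝ}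
    (hc : IsQuadrantCornerSum k c) (hz : ∀ a b, ∃ z : ℤ, c a b = z) :
    quadrantMatrix k c ∈ tsasm (2 * k + 1) := by
  have hd : ∀ i j, quadrantMatrix k c i j = quadrantMatrix k c j i := fun i j =>
    quadrantEntry_comm hc.symm (by omega) (by omega)
  have hrow : ∀ i j, (∑ j' ∈ Finset.Iic j, quadrantMatrix k c i j') = 0 ∨
      (∑ j' ∈ Finset.Iic j, quadrantMatrix k c i j') = 1 := fun i j => by
    have := Fin.sum_Iic_val (fun b => quadrantEntry k c i b) j
    unfold quadrantMatrix
    rw [this, hc.sum_quadrantEntry (by omega) (by omega)]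
    exact hc.quadrantRowSum_eq_zero_or_one hz (by omega) (by omega)
  have hsum : ∀ i, ∑ j, quadrantMatrix k c i j = 1 := fun i => by
    have := Finset.sum_range (n := 2 * k + 1) (fun b => quadrantEntry k c i b)
    unfold quadrantMatrix
    rw [← this, hc.sum_quadrantEntry (by omega) le_rfl, hc.quadrantRowSum_last (by omega)]
  refine ⟨⟨fun i j => ?_, hrow, fun i j => ?_, hsum, fun j => ?_⟩, quadrantMatrix_vert k c, hd⟩
  · have h := Finset.sum_range_succ (fun b => quadrantEntry k c i b) (j : ℕ)
    rw [hc.sum_quadrantEntry (by omega) (by omega), hc.sum_quadrantEntry (by omega) (by omega)]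
      at h
    have h1 := hc.quadrantRowSum_eq_zero_or_one hz (show (i : ℕ) ≤ 2 * k by omega)
      (show (j : ℕ) ≤ 2 * k + 1 by omega)
    have h2 := hc.quadrantRowSum_eq_zero_or_one hz (show (i : ℕ) ≤ 2 * k by omega)
      (show (j : ℕ) + 1 ≤ 2 * k + 1 by omega)
    change quadrantEntry k c i j = -1 ∨ quadrantEntry k c i j = 0 ∨ quadrantEntry k c i j = 1
    rcases h1 with h1 | h1 <;> rcases h2 with h2 | h2 <;> rw [h1, h2] at h
    · right; left; linarith
    · right; right; linarith
    · left; linarith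
    · right; left; linarith
  · simpa only [hd _ j] using hrow j i
  · simpa only [hd _ j] using hsum j

open MeasureTheory in
/-- A matrix of the polytope is the average of the totally symmetric alternating sign matrices
obtained by rounding its corner sums. -/
theorem IsQuadrantCornerSum.quadrantMatrix_mem_convexHull {k : ℕ} {c : ℕ → ℕ → ℝ}
    (hc : IsQuadrantCornerSum k c) :
    quadrantMatrix k c ∈ convexHull ℝ (tsasm (2 * k + 1)) := by
  let μ : Measure ℝ := volume.restrict (Set.Ico 0 1)
  let F : ℝ → Fin (2 * k + 1) → Fin (2 * k + 1) → ℝ :=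
    fun θ => quadrantMatrix k (fun a b => (⌊c a b + θ⌋ : ℝ))
  have : IsProbabilityMeasure μ := ⟨by simp [μ]⟩
  have hi : ∀ x : ℝ, Integrable (fun θ : ℝ => (⌊x + θ⌋ : ℝ)) μ := fun x => (integral_floor_add x).1
  have hv : ∀ x : ℝ, ∫ θ, (⌊x + θ⌋ : ℝ) ∂μ = x := fun x => (integral_floor_add x).2
  have hcomb : ∀ x y z w : ℝ,
      Integrable (fun θ : ℝ => (⌊x + θ⌋ - ⌊y + θ⌋ - ⌊z + θ⌋ + ⌊w + θ⌋ : ℝ)) μ ∧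
        ∫ θ, (⌊x + θ⌋ - ⌊y + θ⌋ - ⌊z + θ⌋ + ⌊w + θ⌋ : ℝ) ∂μ = x - y - z + w := by
    intro x y z w
    have h1 : Integrable (fun θ : ℝ => (⌊x + θ⌋ - ⌊y + θ⌋ : ℝ)) μ := (hi x).sub (hi y)
    have h2 : Integrable (fun θ : ℝ => (⌊x + θ⌋ - ⌊y + θ⌋ - ⌊z + θ⌋ : ℝ)) μ := h1.sub (hi z)
    refine ⟨h2.add (hi w), ?_⟩
    rw [integral_add h2 (hi w), integral_sub h1 (hi z), integral_sub (hi x) (hi y), hv, hv, hv, hv]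
  have hF : ∀ i j, Integrable (fun θ => F θ i j) μ ∧ ∫ θ, F θ i j ∂μ = quadrantMatrix k c i j := by
    intro i j
    simp only [F, quadrantMatrix, quadrantEntry]
    split_ifs
    · exact ⟨integrable_const _, by simp⟩
    · exact ⟨integrable_const _, by simp⟩
    · exact hcomb _ _ _ _
  have hFi : ∀ i, Integrable (fun θ => F θ i) μ := fun i => .of_eval fun j => (hF i j).1
  have hFint : Integrable F μ := .of_eval hFi
  have heq : ∫ θ, F θ ∂μ = quadrantMatrix k c := by
    ext i j
    rw [eval_integral hFi, eval_integral fun j => (hF i j).1, (hF i j).2]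
  have hfin : (tsasm (2 * k + 1)).Finite := by
    refine Set.Finite.subset (Set.Finite.pi' fun _ => Set.Finite.pi' fun _ =>
      (Set.toFinite ({-1, 0, 1} : Set ℝ))) fun X hX i j => ?_
    simpa using hX.1.1 i j
  rw [← heq]
  refine (convex_convexHull ℝ _).integral_mem (hfin.isClosed_convexHull ℝ) ?_ hFint
  refine (ae_restrict_iff' measurableSet_Ico).2 (.of_forall fun θ hθ => subset_convexHull ℝ _ ?_)
  exact (hc.floor_add hθ.1 hθ.2).quadrantMatrix_mem_tsasm fun a b => ⟨_, rfl⟩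

namespace IsTSPoint

variable {k : ℕ} {X : Fin (2 * k + 1) → Fin (2 * k + 1) → ℝ}

theorem isQuadrantCornerSum (hX : IsTSPoint k X) :
    IsQuadrantCornerSum k (fun a b => cornerSum (2 * k + 1) a b X) where
  symm a _ b _ := cornerSum_comm hX.diag a b
  zero_left b _ := cornerSum_zero_left b
  last a ha := by
    induction a with
    | zero => simp [cornerSum_zero_left]
    | succ a ih =>
      have h := two_mul_sum_add_middle hX.row.2 hX.vert (show a < 2 * k + 1 by omega)
      rw [hX.mid a (by omega), neg_one_pow_eq_one_sub_two_mul_mod_two] at h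
      simp only [cornerSum_succ_left, ih (by omega)]
      rw [cast_succ_div_two]
      linarith
  le_succ a ha b hb := by
    have h := sum_range_mem_Icc_of_mem_rowPolytope hX.row (show a < 2 * k + 1 by omega)
      (show b ≤ 2 * k + 1 by omega)
    simp only [cornerSum_succ_left]
    linarith [h.1]
  succ_le a ha b hb := by
    have h := sum_range_mem_Icc_of_mem_rowPolytope hX.row (show a < 2 * k + 1 by omega)
      (show b ≤ 2 * k + 1 by omega)
    simp only [cornerSum_succ_left]
    linarith [h.2]

end IsTSPoint

/-- Totally symmetric matrices are determined by the entries of the upper left quadrant. -/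
theorem entryAt_fold {k : ℕ} {X : Fin (2 * k + 1) → Fin (2 * k + 1) → ℝ}
    (hv : ∀ i j, X i j = X i j.rev) (hd : ∀ i j, X i j = X j i) {a b : ℕ}
    (ha : a ≤ 2 * k) (hb : b ≤ 2 * k) :
    entryAt (2 * k + 1) (min a (2 * k - a)) (min b (2 * k - b)) X
      = entryAt (2 * k + 1) a b X := by
  have hcol : ∀ a b, a ≤ 2 * k → b ≤ 2 * k →
      entryAt (2 * k + 1) a (min b (2 * k - b)) X = entryAt (2 * k + 1) a b X := by
    intro a b ha hb
    rcases min_choice b (2 * k - b) with h | h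
    · rw [h]
    · rw [h, ← entryAt_reflect hv (show a < 2 * k + 1 by omega) (show b < 2 * k + 1 by omega)]
      rfl
  rw [hcol _ _ (by omega) hb, entryAt_comm hd, hcol _ _ hb ha, entryAt_comm hd]

theorem IsTSPoint.eq_quadrantMatrix {k : ℕ} {X : Fin (2 * k + 1) → Fin (2 * k + 1) → ℝ}
    (hX : IsTSPoint k X) : X = quadrantMatrix k (fun a b => cornerSum (2 * k + 1) a b X) := by
  ext i j
  rw [← entryAt_val X i j]
  simp only [quadrantMatrix, quadrantEntry]
  split_ifs with h1 h2
  · rw [h1, entryAt_comm hX.diag, hX.mid _ (by omega)]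
  · rw [h2, hX.mid _ (by omega)]
  · rw [← entryAt_eq_cornerSum, entryAt_fold hX.vert hX.diag (by omega) (by omega)]

theorem convex_symmetric (n : ℕ) :
    Convex ℝ {X : Fin n → Fin n → ℝ | (∀ i j, X i j = X i j.rev) ∧ ∀ i j, X i j = X j i} := by
  rintro X ⟨hX1, hX2⟩ Y ⟨hY1, hY2⟩ s t _ _ _
  refine ⟨fun i j => ?_, fun i j => ?_⟩
  · simp only [Pi.add_apply, Pi.smul_apply]; rw [hX1, hY1]
  · simp only [Pi.add_apply, Pi.smul_apply]; rw [hX2, hY2]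

theorem convex_vertical (n : ℕ) :
    Convex ℝ {X : Fin n → Fin n → ℝ | ∀ i j, X i j = X i j.rev} := by
  intro X hX Y hY s t _ _ _ i j
  simp only [Pi.add_apply, Pi.smul_apply]; rw [hX, hY]

theorem convex_middle_column (k : ℕ) :
    Convex ℝ {X : Fin (2 * k + 1) → Fin (2 * k + 1) → ℝ |
      ∀ a < 2 * k + 1, entryAt (2 * k + 1) a k X = (-1) ^ a} := by
  intro X hX Y hY s t _ _ hst a ha
  rw [map_add, map_smul, map_smul, hX a ha, hY a ha, ← add_smul, hst, one_smul]

/-- Points of the polytope of vertically symmetric alternating sign matrices which are diagonally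
symmetric satisfy the linear description. -/
theorem isTSPoint_of_mem_convexHull_vsasm {k : ℕ} {X : Fin (2 * k + 1) → Fin (2 * k + 1) → ℝ}
    (hX : X ∈ convexHull ℝ {X : Fin (2 * k + 1) → Fin (2 * k + 1) → ℝ |
      IsASM (2 * k + 1) X ∧ ∀ i j, X i j = X i j.rev}) (hd : ∀ i j, X i j = X j i) :
    IsTSPoint k X := by
  refine ⟨convexHull_isASM_subset_rowPolytope _ (convexHull_mono (fun X h => h.1) hX), ?_, hd, ?_⟩
  · exact convexHull_min (fun X h => h.2) (convex_vertical _) hX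
  · exact convexHull_min (t := {X | ∀ a < 2 * k + 1, entryAt (2 * k + 1) a k X = (-1) ^ a})
      (fun X h a ha => h.1.middle_column h.2 ha) (convex_middle_column k) hX

theorem convexHull_tsasm_subset_vsasm (n : ℕ) :
    convexHull ℝ (tsasm n) ⊆ convexHull ℝ {X : Fin n → Fin n → ℝ |
        IsASM n X ∧ ∀ i j, X i j = X i j.rev} ∩ {X : Fin n → Fin n → ℝ | ∀ i j, X i j = X j i} :=
  fun _ hX => ⟨convexHull_mono (by exact fun _ h => ⟨h.1, h.2.1⟩) hX,
    (convexHull_min (t := {X : Fin n → Fin n → ℝ |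
      (∀ i j, X i j = X i j.rev) ∧ ∀ i j, X i j = X j i})
      (fun _ h => h.2) (convex_symmetric n) hX).2⟩

/-- The linear description of the polytope of totally symmetric alternating sign matrices. -/
theorem mem_convexHull_tsasm_iff {k : ℕ} {X : Fin (2 * k + 1) → Fin (2 * k + 1) → ℝ} :
    X ∈ convexHull ℝ (tsasm (2 * k + 1)) ↔ IsTSPoint k X := by
  refine ⟨fun hX => ?_, fun hX => ?_⟩
  · have h := convexHull_tsasm_subset_vsasm _ hX
    exact isTSPoint_of_mem_convexHull_vsasm h.1 h.2
  · rw [hX.eq_quadrantMatrix]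
    exact hX.isQuadrantCornerSum.quadrantMatrix_mem_convexHull

theorem entryAt_quadrantMatrix {k : ℕ} (c : ℕ → ℕ → ℝ) {a b : ℕ} (ha : a ≤ 2 * k)
    (hb : b ≤ 2 * k) : entryAt (2 * k + 1) a b (quadrantMatrix k c) = quadrantEntry k c a b :=
  entryAt_of_lt _ (by omega) (by omega)

theorem IsQuadrantCornerSum.cornerSum_quadrantMatrix {k : ℕ} {c : ℕ → ℕ → ℝ}
    (hc : IsQuadrantCornerSum k c) {a b : ℕ} (ha : a ≤ k) (hb : b ≤ k) :
    cornerSum (2 * k + 1) a b (quadrantMatrix k c) = c a b := by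
  rw [← hc.sum_sum_quadrantEntry ha hb]
  simp only [cornerSum, LinearMap.sum_apply]
  refine Finset.sum_congr rfl fun a' ha' => Finset.sum_congr rfl fun b' hb' => ?_
  rw [Finset.mem_range] at ha' hb'
  exact entryAt_quadrantMatrix c (by omega) (by omega)

/-- The positions at which the corner sums of totally symmetric alternating sign matrices of size
`2 * k + 1` vary: `⟨j, i⟩` stands for `(i + 2, j + 2)`, where `i ≤ j < k - 2`. -/
abbrev FreeCorner (k : ℕ) : Type := Σ j : Fin (k - 2), Fin (j + 1)

theorem card_freeCorner (k : ℕ) : Fintype.card (FreeCorner k) * 2 = (k - 2) * (k - 2 + 1) := by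
  have h : ∀ m : ℕ, (∑ j ∈ Finset.range m, (j + 1)) * 2 = m * (m + 1) := by
    intro m
    induction m with
    | zero => simp
    | succ m ih => rw [Finset.sum_range_succ, add_mul, ih]; ring
  rw [Fintype.card_sigma]
  simp only [Fintype.card_fin]
  rw [Fin.sum_univ_eq_sum_range (fun j => j + 1), h]

/-- The corner sums at the free positions. -/
def freeCornerSum (k : ℕ) :
    (Fin (2 * k + 1) → Fin (2 * k + 1) → ℝ) →ₗ[ℝ] FreeCorner k → ℝ :=
  LinearMap.pi fun t => cornerSum (2 * k + 1) (t.2 + 2) (t.1 + 2)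

/-- Linear equations for the direction of the polytope of totally symmetric alternating sign
matrices of size `2 * k + 1`. -/
def tsDirection (k : ℕ) : Submodule ℝ (Fin (2 * k + 1) → Fin (2 * k + 1) → ℝ) where
  carrier := {X | (∀ i j, X i j = X i j.rev) ∧ (∀ i j, X i j = X j i) ∧
    (∀ a < 2 * k + 1, entryAt (2 * k + 1) a k X = 0) ∧
    (∀ a ≤ k, cornerSum (2 * k + 1) a k X = 0) ∧ ∀ b ≤ k, cornerSum (2 * k + 1) 1 b X = 0}
  zero_mem' := by simp
  add_mem' := by
    rintro X Y ⟨h1, h2, h3, h4, h5⟩ ⟨h1', h2', h3', h4', h5'⟩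
    refine ⟨fun i j => ?_, fun i j => ?_, fun a ha => ?_, fun a ha => ?_, fun b hb => ?_⟩
    · simp only [Pi.add_apply]; rw [h1, h1']
    · simp only [Pi.add_apply]; rw [h2, h2']
    · rw [map_add, h3 a ha, h3' a ha, add_zero]
    · rw [map_add, h4 a ha, h4' a ha, add_zero]
    · rw [map_add, h5 b hb, h5' b hb, add_zero]
  smul_mem' := by
    rintro r X ⟨h1, h2, h3, h4, h5⟩
    refine ⟨fun i j => ?_, fun i j => ?_, fun a ha => ?_, fun a ha => ?_, fun b hb => ?_⟩
    · simp only [Pi.smul_apply]; rw [h1]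
    · simp only [Pi.smul_apply]; rw [h2]
    · rw [map_smul, h3 a ha, smul_zero]
    · rw [map_smul, h4 a ha, smul_zero]
    · rw [map_smul, h5 b hb, smul_zero]

theorem vectorSpan_le_tsDirection {k : ℕ} (hk : 1 ≤ k) :
    vectorSpan ℝ (convexHull ℝ (tsasm (2 * k + 1))) ≤ tsDirection k := by
  refine Submodule.span_le.2 ?_
  rintro _ ⟨X, hX, Y, hY, rfl⟩
  rw [mem_convexHull_tsasm_iff] at hX hY
  have hcX := hX.isQuadrantCornerSum
  have hcY := hY.isQuadrantCornerSum
  refine ⟨fun i j => ?_, fun i j => ?_, fun a ha => ?_, fun a ha => ?_, fun b hb => ?_⟩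
  · simp only [vsub_eq_sub, Pi.sub_apply]; rw [hX.vert, hY.vert]
  · simp only [vsub_eq_sub, Pi.sub_apply]; rw [hX.diag, hY.diag]
  · simp only [vsub_eq_sub, map_sub, hX.mid a ha, hY.mid a ha, sub_self]
  · simp only [vsub_eq_sub, map_sub, hcX.last a ha, hcY.last a ha, sub_self]
  · simp only [vsub_eq_sub, map_sub, hcX.one_left hk hb, hcY.one_left hk hb, sub_self]

theorem eq_zero_of_mem_tsDirection {k : ℕ} {X : Fin (2 * k + 1) → Fin (2 * k + 1) → ℝ}
    (hX : X ∈ tsDirection k) (h0 : freeCornerSum k X = 0) : X = 0 := by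
  obtain ⟨hv, hd, hm, hl, ho⟩ := hX
  have hle : ∀ a b, a ≤ b → b ≤ k → cornerSum (2 * k + 1) a b X = 0 := by
    intro a b hab hb
    rcases Nat.eq_zero_or_pos a with rfl | ha
    · exact cornerSum_zero_left b
    rcases Nat.lt_or_ge a 2 with ha2 | ha2
    · obtain rfl : a = 1 := by omega
      exact ho b hb
    rcases hb.eq_or_lt with rfl | hb
    · exact hl a hab
    have h := congrFun h0 ⟨⟨b - 2, by omega⟩, ⟨a - 2, by simp only; omega⟩⟩
    simpa [freeCornerSum, show a - 2 + 2 = a by omega, show b - 2 + 2 = b by omega] using h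
  have hcorner : ∀ a b, a ≤ k → b ≤ k → cornerSum (2 * k + 1) a b X = 0 := by
    intro a b ha hb
    rcases le_total a b with h | h
    · exact hle a b h hb
    · rw [cornerSum_comm hd]; exact hle b a h ha
  ext i j
  rw [← entryAt_val X i j, ← entryAt_fold hv hd (show (i : ℕ) ≤ 2 * k by omega)
    (show (j : ℕ) ≤ 2 * k by omega)]
  by_cases hj : (j : ℕ) = k
  · rw [hj, show min k (2 * k - k) = k by omega, hm _ (by omega)]; rfl
  by_cases hi : (i : ℕ) = k
  · rw [hi, show min k (2 * k - k) = k by omega, entryAt_comm hd, hm _ (by omega)]; rfl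
  rw [entryAt_eq_cornerSum, hcorner _ _ (by omega) (by omega), hcorner _ _ (by omega) (by omega),
    hcorner _ _ (by omega) (by omega), hcorner _ _ (by omega) (by omega)]
  simp

/-- Corner sums of a relative interior point of the polytope of totally symmetric alternating sign
matrices. -/
noncomputable def interiorCorner (k a b : ℕ) : ℝ :=
  if max a b = k then ((min a b / 2 : ℕ) : ℝ)
  else ((min a b - 1 : ℕ) : ℝ) * (1 / 4 + (max a b : ℕ) * (1 / (4 * k)))

/-- Consecutive values of `interiorCorner` differ by at least `1 / (4 * k)` and at most
`1 - 1 / (4 * k)`, away from the boundary positions with prescribed values. -/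
theorem interiorCorner_succ_sub {k : ℕ} (hk : 1 ≤ k) {a b : ℕ} (ha : a < k) (hb : b ≤ k) :
    (interiorCorner k (a + 1) b - interiorCorner k a b ∈ Set.Icc (0 : ℝ) 1) ∧
    (2 ≤ a → 2 ≤ b → b < k → 1 / (4 * k) ≤ interiorCorner k (a + 1) b - interiorCorner k a b) ∧
    (b < k → interiorCorner k (a + 1) b - interiorCorner k a b ≤ 1 - 1 / (4 * k)) := by
  obtain ⟨u, hu⟩ : ∃ u : ℝ, u = 1 / (4 * k) := ⟨_, rfl⟩
  have hk' : (1 : ℝ) ≤ k := by exact_mod_cast hk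
  have hku : k * u = 1 / 4 := by rw [hu]; field_simp
  have hu0 : 0 < u := by rw [hu]; positivity
  have hmul : ∀ m ≤ k, (m : ℝ) * u ≤ 1 / 4 := fun m hm => by
    rw [← hku]; gcongr
  unfold interiorCorner
  simp only [← hu]
  have hu4 : u ≤ 1 / 4 := by simpa using hmul 1 hk
  rcases hb.eq_or_lt with rfl | hbk
  · rw [if_pos (by omega), if_pos (by omega), show min (a + 1) b = a + 1 by omega,
      show min a b = a by omega, cast_succ_div_two]
    refine ⟨?_, by omega, by omega⟩
    rcases Nat.mod_two_eq_zero_or_one a with h | h <;> rw [h] <;> simp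
  rw [if_neg (show ¬ max a b = k by omega)]
  rcases Nat.lt_or_ge a b with hab | hab
  · rw [if_neg (show ¬ max (a + 1) b = k by omega), show min (a + 1) b = a + 1 by omega,
      show min a b = a by omega, show max (a + 1) b = b by omega, show max a b = b by omega]
    have hbu := hmul b hb
    have hbu0 : 0 ≤ (b : ℝ) * u := by positivity
    rcases Nat.eq_zero_or_pos a with rfl | ha0
    · refine ⟨by simp, by omega, fun _ => ?_⟩
      simp; linarith
    · obtain ⟨d, rfl⟩ : ∃ d, a = d + 1 := ⟨a - 1, by omega⟩
      simp only [Nat.add_sub_cancel]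
      push_cast
      refine ⟨⟨?_, ?_⟩, fun _ _ _ => ?_, fun _ => ?_⟩ <;> nlinarith
  · rw [show min (a + 1) b = b by omega,
      show min a b = b by omega, show max (a + 1) b = a + 1 by omega, show max a b = a by omega]
    rcases Nat.eq_zero_or_pos b with rfl | hb0
    · refine ⟨by simp, by omega, fun _ => ?_⟩
      simp; linarith
    obtain ⟨d, rfl⟩ : ∃ d, b = d + 1 := ⟨b - 1, by omega⟩
    simp only [Nat.add_sub_cancel]
    have hdu : ((d : ℝ) + 1) * u ≤ 1 / 4 := by exact_mod_cast hmul (d + 1) hb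
    have hdu0 : 0 ≤ (d : ℝ) * u := by positivity
    have hd1 : 1 ≤ d → u ≤ d * u := fun h => by
      have : (1 : ℝ) ≤ d := by exact_mod_cast h
      nlinarith
    by_cases hak : a + 1 = k
    · rw [if_pos hak, cast_succ_div_two]
      have hau : (a : ℝ) * u = 1 / 4 - u := by rw [← hku, ← hak]; push_cast; ring
      have hd2 : ((d / 2 : ℕ) : ℝ) * 2 + ((d % 2 : ℕ) : ℝ) = d := by
        norm_cast; omega
      rw [hau]
      have hmod : ((d % 2 : ℕ) : ℝ) = 0 ∨ ((d % 2 : ℕ) : ℝ) = 1 := by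
        rcases Nat.mod_two_eq_zero_or_one d with h | h <;> rw [h] <;> simp
      have hexp : (d : ℝ) * (1 / 4 + (1 / 4 - u)) = d / 2 - d * u := by ring
      rw [hexp]
      refine ⟨⟨?_, ?_⟩, fun _ h _ => ?_, fun _ => ?_⟩ <;> rcases hmod with h' | h' <;>
        first
        | linarith
        | linarith [hd1 (by omega)]
    · rw [if_neg hak]
      push_cast
      refine ⟨⟨?_, ?_⟩, fun _ h _ => ?_, fun _ => ?_⟩
      · linarith
      · linarith
      · linarith [hd1 (by omega)]
      · linarith

/-- The corner sums `interiorCorner`, raised at a free position and its mirror image. -/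
noncomputable def perturbedCorner (k p q : ℕ) (s : ℝ) (a b : ℕ) : ℝ :=
  interiorCorner k a b + if a = p ∧ b = q ∨ a = q ∧ b = p then s else 0

theorem isQuadrantCornerSum_perturbedCorner {k p q : ℕ} (hp : 2 ≤ p) (hpq : p ≤ q) (hq : q < k)
    {s : ℝ} (h0 : 0 ≤ s) (hs : s ≤ 1 / (4 * k)) :
    IsQuadrantCornerSum k (perturbedCorner k p q s) where
  symm a _ b _ := by
    have h : (a = p ∧ b = q ∨ a = q ∧ b = p) = (b = p ∧ a = q ∨ b = q ∧ a = p) := by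
      apply propext; omega
    simp only [perturbedCorner, interiorCorner, min_comm a b, max_comm a b, h]
  zero_left b hb := by
    rw [perturbedCorner, if_neg (by omega), interiorCorner]
    split_ifs <;> simp
  last a ha := by
    rw [perturbedCorner, if_neg (by omega), interiorCorner, if_pos (by omega),
      show min a k = a by omega, add_zero]
  le_succ a ha b hb := by
    obtain ⟨h1, h2, -⟩ := interiorCorner_succ_sub (show 1 ≤ k by omega) ha hb
    unfold perturbedCorner
    by_cases h : a = p ∧ b = q ∨ a = q ∧ b = p
    · have := h2 (by omega) (by omega) (by omega)
      rw [if_pos h]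
      split_ifs <;> linarith
    · rw [if_neg h]
      split_ifs <;> linarith [h1.1]
  succ_le a ha b hb := by
    obtain ⟨h1, -, h2⟩ := interiorCorner_succ_sub (show 1 ≤ k by omega) ha hb
    unfold perturbedCorner
    by_cases h : a + 1 = p ∧ b = q ∨ a + 1 = q ∧ b = p
    · have := h2 (by omega)
      rw [if_pos h]
      split_ifs <;> linarith
    · rw [if_neg h]
      split_ifs <;> linarith [h1.2]

theorem map_freeCornerSum_vectorSpan (k : ℕ) :
    (vectorSpan ℝ (convexHull ℝ (tsasm (2 * k + 1)))).map (freeCornerSum k) = ⊤ := by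
  refine Submodule.eq_top_iff'.2 fun f => ?_
  rw [← Finset.univ_sum_single f]
  refine Submodule.sum_mem _ fun t _ => ?_
  have ht1 := t.1.2
  have ht2 := t.2.2
  have hk : (0 : ℝ) < 1 / (4 * k) := by
    have : (0 : ℝ) < k := by exact_mod_cast (show 0 < k by omega)
    positivity
  let M : ℝ → Fin (2 * k + 1) → Fin (2 * k + 1) → ℝ :=
    fun s => quadrantMatrix k (perturbedCorner k (t.2 + 2) (t.1 + 2) s)
  have hc : ∀ s : ℝ, 0 ≤ s → s ≤ 1 / (4 * k) →
      IsQuadrantCornerSum k (perturbedCorner k (t.2 + 2) (t.1 + 2) s) := fun s h0 hs =>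
    isQuadrantCornerSum_perturbedCorner (by omega) (by omega) (by omega) h0 hs
  have hmem : M (1 / (4 * k)) - M 0 ∈ vectorSpan ℝ (convexHull ℝ (tsasm (2 * k + 1))) :=
    vsub_mem_vectorSpan ℝ (hc _ hk.le le_rfl).quadrantMatrix_mem_convexHull
      (hc _ le_rfl hk.le).quadrantMatrix_mem_convexHull
  have hval : freeCornerSum k (M (1 / (4 * k)) - M 0) = Pi.single t (1 / (4 * k) : ℝ) := by
    ext t'
    have ht1' := t'.1.2
    have ht2' := t'.2.2
    simp only [freeCornerSum, LinearMap.pi_apply, map_sub, M]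
    rw [(hc _ hk.le le_rfl).cornerSum_quadrantMatrix (by omega) (by omega),
      (hc _ le_rfl hk.le).cornerSum_quadrantMatrix (by omega) (by omega)]
    simp only [perturbedCorner, ite_self, add_zero, add_sub_cancel_left]
    by_cases h : t' = t
    · subst h; simp
    · rw [Pi.single_eq_of_ne h, if_neg]
      intro hor
      apply h
      have h1 : t'.1 = t.1 := by ext; omega
      have h2 : (t'.2 : ℕ) = t.2 := by omega
      obtain ⟨j', i'⟩ := t'
      obtain ⟨j, i⟩ := t
      subst h1
      obtain rfl : i' = i := Fin.ext h2
      rfl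
  refine ⟨(f t * (4 * k)) • (M (1 / (4 * k)) - M 0), Submodule.smul_mem _ _ hmem, ?_⟩
  rw [map_smul, hval, ← Pi.single_smul, smul_eq_mul]
  have : (4 * k : ℝ) ≠ 0 := fun h => by rw [h] at hk; simp at hk
  rw [mul_assoc, mul_one_div_cancel this, mul_one]

/-- The dimension of the polytope of totally symmetric alternating sign matrices. -/
theorem finrank_vectorSpan_convexHull_tsasm {k : ℕ} (hk : 1 ≤ k) :
    Module.finrank ℝ (vectorSpan ℝ (convexHull ℝ (tsasm (2 * k + 1))))
      = Fintype.card (FreeCorner k) := by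
  have hinj : Set.InjOn (freeCornerSum k) (vectorSpan ℝ (convexHull ℝ (tsasm (2 * k + 1)))) := by
    intro X hX Y hY hXY
    refine sub_eq_zero.1 (eq_zero_of_mem_tsDirection
      (vectorSpan_le_tsDirection hk (Submodule.sub_mem _ hX hY)) ?_)
    rw [map_sub, hXY, sub_self]
  rw [← Module.finrank_fintype_fun_eq_card (R := ℝ), ← finrank_top ℝ (FreeCorner k → ℝ),
    ← map_freeCornerSum_vectorSpan k]
  exact (LinearEquiv.ofBijective
    ((freeCornerSum k).submoduleMap (vectorSpan ℝ (convexHull ℝ (tsasm (2 * k + 1)))))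
    ⟨fun X Y h => Subtype.ext (hinj X.2 Y.2 (congrArg Subtype.val h)),
      LinearMap.submoduleMap_surjective _ _⟩).finrank_eq

/-- The polytope of totally symmetric ASMs equals the intersection of the ASM
polytope, the totally symmetric subspace, and the fixed middle row and column;
it also equals the VSASM polytope intersected with the diagonally symmetric
subspace; and for odd `n ≥ 3` its dimension is `(n-5)(n-3)/8`. -/
theorem TSASM_polytope_description_and_dim (n : ℕ) (hn : 1 ≤ n) :
    (convexHull ℝ
        {X : Fin n → Fin n → ℝ |
          IsASM n X ∧ (∀ i j, X i j = X i j.rev) ∧ (∀ i j, X i j = X j i)}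
      = convexHull ℝ {X : Fin n → Fin n → ℝ | IsASM n X}
        ∩ ({X : Fin n → Fin n → ℝ | ∀ i j, X i j = X i j.rev}
            ∩ {X : Fin n → Fin n → ℝ | ∀ i j, X i j = X j i})
        ∩ {X : Fin n → Fin n → ℝ |
            ∀ i : Fin n,
              X i ⟨n / 2, Nat.div_lt_self (by omega) (by omega)⟩ = (-1) ^ (i : ℕ) ∧
              X ⟨n / 2, Nat.div_lt_self (by omega) (by omega)⟩ i = (-1) ^ (i : ℕ)}) ∧
    (convexHull ℝ
        {X : Fin n → Fin n → ℝ |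
          IsASM n X ∧ (∀ i j, X i j = X i j.rev) ∧ (∀ i j, X i j = X j i)}
      = convexHull ℝ {X : Fin n → Fin n → ℝ | IsASM n X ∧ ∀ i j, X i j = X i j.rev}
        ∩ {X : Fin n → Fin n → ℝ | ∀ i j, X i j = X j i}) ∧
    (Odd n → 3 ≤ n →
      Module.finrank ℝ
          ↥(vectorSpan ℝ
            (convexHull ℝ
              {X : Fin n → Fin n → ℝ |
                IsASM n X ∧ (∀ i j, X i j = X i j.rev) ∧ (∀ i j, X i j = X j i)}))
        = (n - 5) * (n - 3) / 8) := by
  change (convexHull ℝ (tsasm n) = _) ∧ (convexHull ℝ (tsasm n) = _) ∧ (Odd n → 3 ≤ n →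
    Module.finrank ℝ ↥(vectorSpan ℝ (convexHull ℝ (tsasm n))) = _)
  obtain ⟨k, rfl | rfl⟩ := Nat.even_or_odd' n
  · have hvs : {X : Fin (2 * k) → Fin (2 * k) → ℝ |
        IsASM (2 * k) X ∧ ∀ i j, X i j = X i j.rev} = ∅ := by
      refine Set.eq_empty_of_forall_notMem ?_
      rintro X ⟨hX, hv⟩
      have h := two_mul_sum_of_even hX.2.2.2.1 hv (show 0 < 2 * k by omega)
      rcases sum_range_row_eq_zero_or_one hX (show 0 < 2 * k by omega)
        (show k ≤ 2 * k by omega) with h' | h' <;> rw [h'] at h <;> norm_num at h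
    have hts : convexHull ℝ (tsasm (2 * k)) = ∅ := by
      rw [convexHull_eq_empty]
      exact Set.subset_eq_empty (by exact fun _ h => ⟨h.1, h.2.1⟩) hvs
    refine ⟨?_, ?_, fun hodd => absurd hodd (by simp)⟩
    · rw [hts, eq_comm]
      refine Set.eq_empty_of_forall_notMem ?_
      rintro X ⟨⟨hX, hv, -⟩, hm⟩
      have hr := convexHull_isASM_subset_rowPolytope _ hX
      have h0 : 0 < 2 * k := by omega
      have h := two_mul_sum_of_even hr.2 hv h0
      obtain ⟨m, rfl⟩ : ∃ m, k = m + 1 := ⟨k - 1, by omega⟩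
      have h1 := sum_range_mem_Icc_of_mem_rowPolytope hr h0 (show m ≤ 2 * (m + 1) by omega)
      have h2 : entryAt (2 * (m + 1)) 0 (m + 1) X = 1 := by
        rw [entryAt_of_lt X h0 (show m + 1 < 2 * (m + 1) by omega)]
        have := (hm ⟨0, h0⟩).1
        simpa using this
      rw [← entryAt_reflect hv h0 (show m + 1 < 2 * (m + 1) by omega),
        show 2 * (m + 1) - 1 - (m + 1) = m by omega] at h2
      rw [Finset.sum_range_succ, h2] at h
      linarith [h1.1]
    · rw [hts, hvs, convexHull_empty, Set.empty_inter]
  · refine ⟨?_, ?_, fun _ hn3 => ?_⟩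
    · ext X
      rw [mem_convexHull_tsasm_iff]
      have hmid : (⟨(2 * k + 1) / 2, Nat.div_lt_self (by omega) (by omega)⟩ : Fin (2 * k + 1))
          = ⟨k, by omega⟩ := by
        ext; simp only; omega
      refine ⟨fun hX => ⟨⟨?_, hX.vert, hX.diag⟩, fun i => ?_⟩, ?_⟩
      · exact convexHull_mono (by exact fun _ h => h.1) (mem_convexHull_tsasm_iff.2 hX)
      · rw [hX.diag _ i, hmid, and_self, ← hX.mid i i.2]
        exact (entryAt_val X i ⟨k, by omega⟩).symm
      · rintro ⟨⟨hX, hv, hd⟩, hm⟩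
        refine ⟨convexHull_isASM_subset_rowPolytope _ hX, hv, hd, fun a ha => ?_⟩
        rw [entryAt_of_lt X ha (by omega), ← (hm ⟨a, ha⟩).1, hmid]
    · refine (convexHull_tsasm_subset_vsasm _).antisymm ?_
      rintro X ⟨hX, hd⟩
      exact mem_convexHull_tsasm_iff.2 (isTSPoint_of_mem_convexHull_vsasm hX hd)
    · rw [finrank_vectorSpan_convexHull_tsasm (by omega)]
      have h := card_freeCorner k
      have h1 : 2 * k + 1 - 5 = 2 * (k - 2) := by omega
      rcases Nat.lt_or_ge k 2 with hk | hk
      · obtain rfl : k = 1 := by omega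
        simp
      · rw [h1, show 2 * k + 1 - 3 = 2 * (k - 2 + 1) by omega,
          show 2 * (k - 2) * (2 * (k - 2 + 1)) = 8 * Fintype.card (FreeCorner k) by
            rw [show 8 * Fintype.card (FreeCorner k) = 4 * (Fintype.card (FreeCorner k) * 2) by ring,
              h]; ring, Nat.mul_div_cancel_left _ (by norm_num)]
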